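/- Let 0 < α < 1, let A be a real symmetric positive semidefinite n × n matrix, and let f₀ ∈ ℝⁿ. Define f(t) = ∑_{j=0}^∞ (-1)^j t^{α j} / Γ(α j + 1) · (A^j f₀) for t ≥ 0 (the series converges for every t ≥ 0), i.e. f(t) = E_α(-A t^α) f₀. Then f(0) = f₀, each component f_i is differentiable on (0,∞), and for every t > 0 and every index i, the Caputo fractional derivative satisfies D^α f_i(t) = -(A · f(t))_i. In other words, f solves the generalized diffusion equation D^α f(t) = -A f(t) with initial condition f(0) = f₀. -/

import Mathlib

open Matrix

/-- The Caputo fractional derivative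
`D^α y(t) = (1/Γ(1-α)) ∫_0^t y'(τ) (t-τ)^{-α} dτ`. -/
noncomputable def caputoDeriv (α : ℝ) (y : ℝ → ℝ) (t : ℝ) : ℝ :=
  (1 / Real.Gamma (1 - α)) * ∫ τ in (0:ℝ)..t, deriv y τ * (t - τ) ^ (-α)

/-- `f(t) = E_α(-A tᵅ) f₀ = ∑_{j=0}^∞ (-1)^j t^{αj}/Γ(αj+1) · (A^j f₀)`. -/
noncomputable def mlMatrixSolution {n : ℕ} (α : ℝ) (A : Matrix (Fin n) (Fin n) ℝ)
    (f₀ : Fin n → ℝ) (t : ℝ) : Fin n → ℝ :=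
  ∑' j : ℕ, ((-1) ^ j * t ^ (α * j) / Real.Gamma (α * j + 1)) • (A ^ j).mulVec f₀

open MeasureTheory Set in
lemma ml_gamma_lower (s R : ℝ) (hs : 0 ≤ s) (hR : 0 < R) :
    R ^ s * Real.exp (-R) ≤ Real.Gamma (s + 1) := by
  rw [Real.Gamma_eq_integral (by linarith)]
  have h1 := Real.GammaIntegral_convergent (s := s + 1) (by linarith)
  have h2 : ∫ x in Ioi R, Real.exp (-x) * x ^ (s + 1 - 1)
      ≤ ∫ x in Ioi 0, Real.exp (-x) * x ^ (s + 1 - 1) := by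
    apply setIntegral_mono_set h1
    · filter_upwards [ae_restrict_mem measurableSet_Ioi] with x hx
      have : (0:ℝ) < x := hx
      simp only [Pi.zero_apply]
      positivity
    · exact (Ioi_subset_Ioi hR.le).eventuallyLE
  refine le_trans ?_ h2
  have h3 : ∫ x in Ioi R, Real.exp (-x) * R ^ s = R ^ s * Real.exp (-R) := by
    rw [integral_mul_const, integral_exp_neg_Ioi, mul_comm]
  rw [← h3]
  apply setIntegral_mono_on
  · exact (integrableOn_exp_neg_Ioi R).mul_const _
  · exact h1.mono_set (Ioi_subset_Ioi hR.le)
  · exact measurableSet_Ioi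
  · intro x hx
    have hx' : R < x := hx
    rw [add_sub_cancel_right]
    gcongr

lemma ml_summable (α x : ℝ) (hα : 0 < α) (hx : 0 ≤ x) :
    Summable (fun j : ℕ => x ^ j / Real.Gamma (α * j + 1)) := by
  set R : ℝ := (2 * x + 1) ^ (1 / α) with hRdef
  have hR : 0 < R := by positivity
  have hRα : R ^ α = 2 * x + 1 := by
    rw [hRdef, ← Real.rpow_mul (by positivity)]
    field_simp
    simp
  have hg : Summable (fun j : ℕ => Real.exp R * (x / (2 * x + 1)) ^ j) := by
    apply Summable.mul_left
    apply summable_geometric_of_lt_one (by positivity)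
    rw [div_lt_one (by positivity)]
    linarith
  refine Summable.of_nonneg_of_le (fun j => ?_) (fun j => ?_) hg
  · have : 0 < Real.Gamma (α * j + 1) := Real.Gamma_pos_of_pos (by positivity)
    positivity
  · have h := ml_gamma_lower (α * j) R (by positivity) hR
    rw [Real.rpow_mul hR.le, hRα, Real.rpow_natCast] at h
    calc x ^ j / Real.Gamma (α * j + 1) ≤ x ^ j / ((2 * x + 1) ^ j * Real.exp (-R)) := by
          gcongr
      _ = Real.exp R * (x / (2 * x + 1)) ^ j := by
          rw [Real.exp_neg, div_pow]
          field_simp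

lemma ml_summable' (α : ℝ) (hα : 0 < α) (v : ℕ → ℝ) (C M : ℝ) (hM : 0 ≤ M)
    (hv : ∀ j, |v j| ≤ C * M ^ j) (t : ℝ) (ht : 0 ≤ t) :
    Summable (fun j : ℕ => |v j| * (t ^ (α * j) / Real.Gamma (α * j + 1))) := by
  have h := (ml_summable α (M * t ^ α) hα (by positivity)).mul_left C
  refine Summable.of_nonneg_of_le (fun j => ?_) (fun j => ?_) h
  · have : 0 < Real.Gamma (α * j + 1) := Real.Gamma_pos_of_pos (by positivity)
    positivity
  · have : 0 < Real.Gamma (α * j + 1) := Real.Gamma_pos_of_pos (by positivity)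
    calc _ ≤ C * M ^ j * (t ^ (α * j) / Real.Gamma (α * j + 1)) := by
          gcongr
          exact hv j
      _ = _ := by
          rw [Real.rpow_mul ht, Real.rpow_natCast, mul_pow]
          ring

lemma ml_summable_signed (α : ℝ) (hα : 0 < α) (v : ℕ → ℝ) (C M : ℝ) (hM : 0 ≤ M)
    (hv : ∀ j, |v j| ≤ C * M ^ j) (t : ℝ) (ht : 0 ≤ t) :
    Summable (fun j : ℕ => v j * (t ^ (α * j) / Real.Gamma (α * j + 1))) := by
  apply Summable.of_norm
  convert ml_summable' α hα v C M hM hv t ht using 2 with j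
  have : 0 < Real.Gamma (α * j + 1) := Real.Gamma_pos_of_pos (by positivity)
  rw [norm_mul, Real.norm_eq_abs, Real.norm_eq_abs, abs_of_nonneg (a := _ / _) (by positivity)]

lemma ml_hasDeriv (α : ℝ) (hα : 0 < α) (v : ℕ → ℝ) (C M : ℝ) (hM : 0 ≤ M)
    (hv : ∀ j, |v j| ≤ C * M ^ j) (t : ℝ) (ht : 0 < t) :
    HasDerivAt (fun τ : ℝ => ∑' j : ℕ, v j * (τ ^ (α * j) / Real.Gamma (α * j + 1)))
      (∑' k : ℕ, v (k + 1) * (t ^ (α * (k + 1 : ℕ) - 1) / Real.Gamma (α * (k + 1 : ℕ)))) t := by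
  have hu := ((ml_summable' α hα (fun j => 2 ^ j * v j) C (2 * M) (by positivity) (by
    intro j
    rw [abs_mul, abs_of_pos (by positivity), mul_pow]
    have := hv j
    have h2 : (0:ℝ) < 2 ^ j := by positivity
    nlinarith) (2 * t) (by positivity)).mul_left (α * (t / 2)⁻¹))
  have hbd : ∀ (j : ℕ) (y : ℝ), y ∈ Set.Ioo (t / 2) (2 * t) →
      ‖v j * (α * j * y ^ (α * j - 1) / Real.Gamma (α * j + 1))‖ ≤
      α * (t / 2)⁻¹ * (|2 ^ j * v j| * ((2 * t) ^ (α * j) / Real.Gamma (α * j + 1))) := by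
    intro j y hy
    have hy0 : 0 < y := by linarith [hy.1]
    have hG : 0 < Real.Gamma (α * j + 1) := Real.Gamma_pos_of_pos (by positivity)
    rw [norm_mul, Real.norm_eq_abs, Real.norm_eq_abs, abs_of_nonneg (a := _ / _) (by positivity),
      abs_mul, abs_of_pos (a := (2:ℝ) ^ j) (by positivity), Real.rpow_sub hy0, Real.rpow_one]
    have hj : (j : ℝ) ≤ 2 ^ j := by exact_mod_cast Nat.lt_two_pow_self.le
    have h1 : y ^ (α * j) / y ≤ (2 * t) ^ (α * j) / (t / 2) := by
      have := hy.1
      have := hy.2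
      gcongr
    calc |v j| * (α * j * (y ^ (α * j) / y) / Real.Gamma (α * j + 1))
        ≤ |v j| * (α * 2 ^ j * ((2 * t) ^ (α * j) / (t / 2)) / Real.Gamma (α * j + 1)) := by
          gcongr
      _ = _ := by
          simp only [div_eq_mul_inv]
          ring
  have htm : t ∈ Set.Ioo (t / 2) (2 * t) := ⟨by linarith, by linarith⟩
  have key := hasDerivAt_tsum_of_isPreconnected (𝕜 := ℝ) (F := ℝ)
    (g := fun (j : ℕ) (τ : ℝ) => v j * (τ ^ (α * j) / Real.Gamma (α * j + 1)))
    (g' := fun (j : ℕ) (y : ℝ) => v j * (α * j * y ^ (α * j - 1) / Real.Gamma (α * j + 1)))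
    hu isOpen_Ioo isPreconnected_Ioo (by
      intro j y hy
      have hy0 : 0 < y := by linarith [hy.1]
      exact ((Real.hasDerivAt_rpow_const (Or.inl hy0.ne')).div_const _).const_mul _)
    hbd htm (ml_summable_signed α hα v C M hM hv t ht.le) htm
  have hs : Summable (fun j : ℕ => v j * (α * j * t ^ (α * j - 1) / Real.Gamma (α * j + 1))) :=
    Summable.of_norm_bounded hu (fun j => hbd j t htm)
  refine key.congr_deriv ?_
  rw [hs.tsum_eq_zero_add]
  simp only [Nat.cast_zero, mul_zero, zero_mul, zero_div, zero_add]
  congr 1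
  ext k
  have hp : 0 < α * ((k + 1 : ℕ) : ℝ) := by positivity
  have hG := Real.Gamma_pos_of_pos hp
  rw [Real.Gamma_add_one hp.ne']
  field_simp

lemma ml_beta (s r t : ℝ) (hs : 0 < s) (hr : 0 < r) (ht : 0 < t) :
    ∫ x in (0:ℝ)..t, x ^ (s - 1) * (t - x) ^ (r - 1) =
      t ^ (s + r - 1) * (Real.Gamma s * Real.Gamma r / Real.Gamma (s + r)) := by
  have h := Complex.betaIntegral_scaled (s : ℂ) (r : ℂ) ht
  rw [Complex.betaIntegral_eq_Gamma_mul_div _ _ (by simpa) (by simpa)] at h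
  have h2 : ∫ x in (0:ℝ)..t, (x : ℂ) ^ ((s : ℂ) - 1) * ((t : ℂ) - x) ^ ((r : ℂ) - 1) =
      ∫ x in (0:ℝ)..t, ((x ^ (s - 1) * (t - x) ^ (r - 1) : ℝ) : ℂ) := by
    apply intervalIntegral.integral_congr
    intro x hx
    rw [Set.uIcc_of_le ht.le] at hx
    simp only
    rw [Complex.ofReal_mul, Complex.ofReal_cpow hx.1, Complex.ofReal_cpow (by linarith [hx.2])]
    push_cast
    rfl
  rw [h2, intervalIntegral.integral_ofReal] at h
  apply Complex.ofReal_injective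
  rw [h, Complex.ofReal_mul, Complex.ofReal_cpow ht.le]
  push_cast [← Complex.Gamma_ofReal]
  rfl

open MeasureTheory Set in
lemma ml_caputo (α : ℝ) (hα : 0 < α) (hα1 : α < 1) (v : ℕ → ℝ) (C M : ℝ) (hM : 0 ≤ M)
    (hv : ∀ j, |v j| ≤ C * M ^ j) (t : ℝ) (ht : 0 < t) :
    caputoDeriv α (fun τ : ℝ => ∑' j : ℕ, v j * (τ ^ (α * j) / Real.Gamma (α * j + 1))) t
      = ∑' k : ℕ, v (k + 1) * (t ^ (α * k) / Real.Gamma (α * k + 1)) := by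
  have hG1 : 0 < Real.Gamma (1 - α) := Real.Gamma_pos_of_pos (by linarith)
  have hB : ∀ k : ℕ, ∫ x in Ioc 0 t, x ^ (α * (k + 1 : ℕ) - 1) * (t - x) ^ (-α) =
      t ^ (α * k) * (Real.Gamma (α * (k + 1 : ℕ)) * Real.Gamma (1 - α) /
        Real.Gamma (α * k + 1)) := by
    intro k
    have := ml_beta (α * (k + 1 : ℕ)) (1 - α) t (by positivity) (by linarith) ht
    rw [intervalIntegral.integral_of_le ht.le] at this
    rw [show (1 - α - 1) = -α by ring,
      show α * ((k + 1 : ℕ) : ℝ) + (1 - α) = α * k + 1 by push_cast; ring] at this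
    rw [this]
    simp
  have hGk : ∀ k : ℕ, 0 < Real.Gamma (α * (k + 1 : ℕ)) := fun k =>
    Real.Gamma_pos_of_pos (by positivity)
  have hGk1 : ∀ k : ℕ, 0 < Real.Gamma (α * k + 1) := fun k =>
    Real.Gamma_pos_of_pos (by positivity)
  have hI : ∀ k : ℕ, Integrable (fun x : ℝ => x ^ (α * (k + 1 : ℕ) - 1) * (t - x) ^ (-α))
      (volume.restrict (Ioc 0 t)) := by
    intro k
    by_contra hc
    have h1 := hB k
    rw [integral_undef hc] at h1
    have := hGk k
    have := hGk1 k
    have : 0 < t ^ (α * k) * (Real.Gamma (α * (k + 1 : ℕ)) * Real.Gamma (1 - α) /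
        Real.Gamma (α * k + 1)) := by positivity
    linarith
  have hsumv : ∀ j, |v (j + 1)| ≤ (C * M) * M ^ j := by
    intro j
    have := hv (j + 1)
    rw [pow_succ] at this
    linarith
  let F : ℕ → ℝ → ℝ := fun k x =>
    (v (k + 1) / Real.Gamma (α * (k + 1 : ℕ))) * (x ^ (α * (k + 1 : ℕ) - 1) * (t - x) ^ (-α))
  have hFi : ∀ k, Integrable (F k) (volume.restrict (Ioc 0 t)) := fun k => (hI k).const_mul _
  have hFint : ∀ k, ∫ x in Ioc 0 t, F k x =
      Real.Gamma (1 - α) * (v (k + 1) * (t ^ (α * k) / Real.Gamma (α * k + 1))) := by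
    intro k
    have := hGk k
    simp only [F]
    rw [integral_const_mul, hB]
    field_simp
  have hFn : ∀ k, ∫ x in Ioc 0 t, ‖F k x‖ =
      Real.Gamma (1 - α) * (|v (k + 1)| * (t ^ (α * k) / Real.Gamma (α * k + 1))) := by
    intro k
    have := hGk k
    have h1 : ∫ x in Ioc 0 t, ‖F k x‖ = ∫ x in Ioc 0 t,
      (|v (k + 1)| / Real.Gamma (α * (k + 1 : ℕ))) *
        (x ^ (α * (k + 1 : ℕ) - 1) * (t - x) ^ (-α)) := by
      apply setIntegral_congr_fun measurableSet_Ioc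
      intro x hx
      have hx0 : 0 < x := hx.1
      have hx1 : 0 ≤ t - x := by linarith [hx.2]
      simp only [F]
      rw [norm_mul, norm_div, Real.norm_eq_abs, Real.norm_of_nonneg this.le,
        Real.norm_of_nonneg (by positivity)]
    rw [h1, integral_const_mul, hB]
    field_simp
  have hS := hasSum_integral_of_summable_integral_norm hFi (by
    simp_rw [hFn]
    exact (ml_summable' α hα (fun k => v (k + 1)) (C * M) M hM hsumv t ht.le).mul_left _)
  have hE : ∫ τ in Ioc 0 t, deriv (fun τ : ℝ => ∑' j : ℕ, v j *
      (τ ^ (α * j) / Real.Gamma (α * j + 1))) τ * (t - τ) ^ (-α) =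
      ∫ x in Ioc 0 t, ∑' k, F k x := by
    apply setIntegral_congr_fun measurableSet_Ioc
    intro x hx
    simp only [F]
    rw [(ml_hasDeriv α hα v C M hM hv x hx.1).deriv, ← tsum_mul_right]
    congr 1
    ext k
    ring
  rw [caputoDeriv, intervalIntegral.integral_of_le ht.le, hE, ← hS.tsum_eq]
  simp_rw [hFint]
  rw [tsum_mul_left]
  field_simp

lemma ml_matrix_bound {n : ℕ} (A : Matrix (Fin n) (Fin n) ℝ) (f₀ : Fin n → ℝ) (j : ℕ) :
    ∀ i, |((A ^ j).mulVec f₀) i| ≤ (∑ k, |f₀ k|) * (∑ i, ∑ k, |A i k|) ^ j := by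
  induction j with
  | zero =>
    intro i
    simp only [pow_zero, Matrix.one_mulVec, mul_one]
    exact Finset.single_le_sum (f := fun k => |f₀ k|) (fun k _ => abs_nonneg _) (Finset.mem_univ i)
  | succ j ih =>
    intro i
    rw [pow_succ' A, ← Matrix.mulVec_mulVec]
    have hle : ∑ k, |A i k| ≤ ∑ i, ∑ k, |A i k| :=
      Finset.single_le_sum (f := fun i => ∑ k, |A i k|)
        (fun k _ => Finset.sum_nonneg (fun _ _ => abs_nonneg _)) (Finset.mem_univ i)
    have hC : 0 ≤ (∑ k, |f₀ k|) * (∑ i, ∑ k, |A i k|) ^ j := by positivity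
    calc |(A.mulVec ((A ^ j).mulVec f₀)) i| ≤ ∑ k, |A i k * ((A ^ j).mulVec f₀) k| :=
by
          have hmv : (A.mulVec ((A ^ j).mulVec f₀)) i = ∑ k, A i k * ((A ^ j).mulVec f₀) k := rfl
          rw [hmv]
          exact Finset.abs_sum_le_sum_abs _ _
      _ ≤ ∑ k, |A i k| * ((∑ k, |f₀ k|) * (∑ i, ∑ k, |A i k|) ^ j) := by
          apply Finset.sum_le_sum
          intro k _
          rw [abs_mul]
          gcongr
          exact ih k
      _ = (∑ k, |A i k|) * ((∑ k, |f₀ k|) * (∑ i, ∑ k, |A i k|) ^ j) := by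
          exact (Finset.sum_mul _ _ _).symm
      _ ≤ (∑ i, ∑ k, |A i k|) * ((∑ k, |f₀ k|) * (∑ i, ∑ k, |A i k|) ^ j) := by
          gcongr
      _ = _ := by ring

lemma ml_signed_bound {n : ℕ} (A : Matrix (Fin n) (Fin n) ℝ) (f₀ : Fin n → ℝ) (i : Fin n)
    (j : ℕ) : |(-1) ^ j * ((A ^ j).mulVec f₀) i| ≤
      (∑ k, |f₀ k|) * (∑ i, ∑ k, |A i k|) ^ j := by
  rw [abs_mul, abs_pow, abs_neg, abs_one, one_pow, one_mul]
  exact ml_matrix_bound A f₀ j i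

lemma ml_vec_summable {n : ℕ} (α : ℝ) (hα : 0 < α) (A : Matrix (Fin n) (Fin n) ℝ)
    (f₀ : Fin n → ℝ) (t : ℝ) (ht : 0 ≤ t) :
    Summable (fun j : ℕ => ((-1) ^ j * t ^ (α * j) / Real.Gamma (α * j + 1)) •
      (A ^ j).mulVec f₀) := by
  rw [Pi.summable]
  intro i
  convert ml_summable_signed α hα _ _ _ (by positivity) (ml_signed_bound A f₀ i) t ht using 2
  simp only [Pi.smul_apply, smul_eq_mul]
  ring

lemma ml_component {n : ℕ} (α : ℝ) (hα : 0 < α) (A : Matrix (Fin n) (Fin n) ℝ)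
    (f₀ : Fin n → ℝ) (t : ℝ) (ht : 0 ≤ t) (i : Fin n) :
    mlMatrixSolution α A f₀ t i = ∑' j : ℕ, ((-1) ^ j * ((A ^ j).mulVec f₀) i) *
      (t ^ (α * j) / Real.Gamma (α * j + 1)) := by
  rw [mlMatrixSolution, tsum_apply (ml_vec_summable α hα A f₀ t ht)]
  congr 1
  ext j
  simp only [Pi.smul_apply, smul_eq_mul]
  ring

/-- for a symmetric positive semidefinite matrix `A`,
`f(t) = E_α(-A tᵅ) f₀` solves the generalized diffusion equation
`D^α f = -A f` with `f(0) = f₀`. -/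
theorem mittagLeffler_solves_matrix_GDE
    {n : ℕ} (α : ℝ) (hα : 0 < α) (hα1 : α < 1)
    (A : Matrix (Fin n) (Fin n) ℝ) (hA : A.PosSemidef) (f₀ : Fin n → ℝ) :
    mlMatrixSolution α A f₀ 0 = f₀ ∧
    (∀ (i : Fin n) (t : ℝ), 0 < t →
      DifferentiableAt ℝ (fun τ => mlMatrixSolution α A f₀ τ i) t) ∧
    (∀ (i : Fin n) (t : ℝ), 0 < t →
      caputoDeriv α (fun τ => mlMatrixSolution α A f₀ τ i) t =
        -(A.mulVec (mlMatrixSolution α A f₀ t)) i) := by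
  have hM : 0 ≤ ∑ i, ∑ k, |A i k| := by positivity
  refine ⟨?_, ?_, ?_⟩
  · rw [mlMatrixSolution, tsum_eq_single 0]
    · simp
    · intro j hj
      have : α * (j : ℝ) ≠ 0 := by positivity
      simp [Real.zero_rpow this]
  · intro i t ht
    have h := (ml_hasDeriv α hα _ _ _ hM (ml_signed_bound A f₀ i) t ht).differentiableAt
    refine h.congr_of_eventuallyEq ?_
    filter_upwards [lt_mem_nhds ht] with τ hτ
    exact ml_component α hα A f₀ τ hτ.le i
  · intro i t ht
    have h := ml_caputo α hα hα1 _ _ _ hM (ml_signed_bound A f₀ i) t ht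
    have h0 : caputoDeriv α (fun τ => mlMatrixSolution α A f₀ τ i) t =
        caputoDeriv α (fun τ : ℝ => ∑' j : ℕ, ((-1) ^ j * ((A ^ j).mulVec f₀) i) *
          (τ ^ (α * j) / Real.Gamma (α * j + 1))) t := by
      rw [caputoDeriv, caputoDeriv, intervalIntegral.integral_of_le ht.le,
        intervalIntegral.integral_of_le ht.le]
      congr 1
      apply MeasureTheory.setIntegral_congr_fun measurableSet_Ioc
      intro x hx
      simp only
      congr 1
      apply Filter.EventuallyEq.deriv_eq
      filter_upwards [lt_mem_nhds hx.1] with τ hτ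
      exact ml_component α hα A f₀ τ hτ.le i
    rw [h0, h]
    have hmv : (A.mulVec (mlMatrixSolution α A f₀ t)) i =
        ∑ k, A i k * mlMatrixSolution α A f₀ t k := rfl
    rw [hmv]
    simp_rw [ml_component α hα A f₀ t ht.le, ← tsum_mul_left]
    rw [← Summable.tsum_finsetSum (fun k _ => (ml_summable_signed α hα _ _ _ hM
      (ml_signed_bound A f₀ k) t ht.le).mul_left _), ← tsum_neg]
    congr 1
    ext j
    rw [pow_succ' A, ← Matrix.mulVec_mulVec]
    have hmv2 : (A.mulVec ((A ^ j).mulVec f₀)) i = ∑ k, A i k * ((A ^ j).mulVec f₀) k := rfl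
    rw [hmv2, Finset.mul_sum, Finset.sum_mul, ← Finset.sum_neg_distrib]
    apply Finset.sum_congr rfl
    intro k _
    ring
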